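/- For every z ≠ 0, the TTF transformation R is differentiable at z with derivative R'(z) = σ·√(2/π)·exp(−z²/2)·erfc(|z|/√2)^(−λ_s−1), where λ_s = λ₊ for z > 0 and λ_s = λ₋ for z < 0; in particular R'(z) > 0 for every z ≠ 0, and R is strictly increasing on ℝ. -/

import Mathlib

open MeasureTheory Real Filter

/-- The complementary error function `erfc(z) = (2/√π) ∫_z^∞ exp(-t²) dt`. -/
noncomputable def erfc (z : ℝ) : ℝ :=
  (2 / Real.sqrt Real.pi) * ∫ t in Set.Ioi z, Real.exp (-t ^ 2)

/-- The TTF transformation `R(z) = μ + σ (s/λ_s)(erfc(|z|/√2)^(-λ_s) - 1)`, where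
`s = sign(z)` (`s = 1` for `z ≥ 0`, `s = -1` for `z < 0`), `λ_s = λ₊` when `s = 1`
and `λ_s = λ₋` when `s = -1`. -/
noncomputable def ttfR (m σ lp lm z : ℝ) : ℝ :=
  if 0 ≤ z then
    m + σ * ((1 / lp) * ((erfc (|z| / Real.sqrt 2)) ^ (-lp) - 1))
  else
    m + σ * ((-1 / lm) * ((erfc (|z| / Real.sqrt 2)) ^ (-lm) - 1))

lemma integrable_gauss : Integrable (fun t : ℝ => Real.exp (-t ^ 2)) := by
  simpa using integrable_exp_neg_mul_sq (b := 1) one_pos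

lemma erfc_eq (z : ℝ) : erfc z = (2 / Real.sqrt Real.pi) *
    ((∫ t in Set.Ioi (0 : ℝ), Real.exp (-t ^ 2)) - ∫ t in (0 : ℝ)..z, Real.exp (-t ^ 2)) := by
  unfold erfc
  rw [← intervalIntegral.integral_Ioi_sub_Ioi' integrable_gauss.integrableOn
    integrable_gauss.integrableOn]
  ring

lemma erfc_hasDerivAt (z : ℝ) :
    HasDerivAt erfc (-((2 / Real.sqrt Real.pi) * Real.exp (-z ^ 2))) z := by
  have hc : Continuous (fun t : ℝ => Real.exp (-t ^ 2)) := by fun_prop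
  have h := ((hc.integral_hasStrictDerivAt 0 z).hasDerivAt.const_sub
    (∫ t in Set.Ioi (0 : ℝ), Real.exp (-t ^ 2))).const_mul (2 / Real.sqrt Real.pi)
  have he : erfc = fun z => (2 / Real.sqrt Real.pi) *
    ((∫ t in Set.Ioi (0 : ℝ), Real.exp (-t ^ 2)) - ∫ t in (0 : ℝ)..z, Real.exp (-t ^ 2)) :=
    funext erfc_eq
  rw [he]
  exact h.congr_deriv (by ring)

lemma erfc_zero : erfc 0 = 1 := by
  have h := integral_gaussian_Ioi 1
  have hp : 0 < Real.sqrt Real.pi := Real.sqrt_pos.2 Real.pi_pos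
  simp only [div_one, neg_mul, one_mul] at h
  unfold erfc
  rw [h]
  field_simp

lemma erfc_strictAnti : StrictAnti erfc := by
  apply strictAnti_of_deriv_neg
  intro z
  rw [(erfc_hasDerivAt z).deriv]
  have hp : 0 < Real.sqrt Real.pi := Real.sqrt_pos.2 Real.pi_pos
  have : 0 < (2 / Real.sqrt Real.pi) * Real.exp (-z ^ 2) := by positivity
  linarith

lemma erfc_pos (z : ℝ) : 0 < erfc z := by
  have hn : ∀ x, 0 ≤ erfc x := fun x => by
    unfold erfc
    exact mul_nonneg (by positivity) (integral_nonneg fun t => (Real.exp_pos _).le)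
  exact (hn (z + 1)).trans_lt (erfc_strictAnti (by linarith))

lemma erfc_rpow_hasDerivAt (l c z : ℝ) (hc : c ^ 2 = 1) :
    HasDerivAt (fun z => erfc (c * z / Real.sqrt 2) ^ (-l))
      (c * l * (Real.sqrt (2 / Real.pi) * Real.exp (-z ^ 2 / 2)
        * erfc (c * z / Real.sqrt 2) ^ (-l - 1))) z := by
  have h1 : HasDerivAt (fun z : ℝ => c * z / Real.sqrt 2) (c * 1 / Real.sqrt 2) z :=
    ((hasDerivAt_id z).const_mul c).div_const _
  have h2 := (erfc_hasDerivAt (c * z / Real.sqrt 2)).comp z h1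
  have h3 := h2.rpow_const (p := -l) (Or.inl (erfc_pos _).ne')
  have hp : 0 < Real.sqrt Real.pi := Real.sqrt_pos.2 Real.pi_pos
  have h2p : 0 < Real.sqrt 2 := by positivity
  have h2s : Real.sqrt 2 ^ 2 = 2 := Real.sq_sqrt (by norm_num)
  have e : -(c * z / Real.sqrt 2) ^ 2 = -z ^ 2 / 2 := by
    rw [div_pow, mul_pow, hc, h2s]; ring
  have e2 : Real.sqrt (2 / Real.pi) = 2 / Real.sqrt Real.pi / Real.sqrt 2 := by
    rw [Real.sqrt_div (by norm_num)]
    field_simp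
    exact h2s
  rw [e] at h3
  refine HasDerivAt.congr_deriv (f := fun z => erfc (c * z / Real.sqrt 2) ^ (-l)) h3 ?_
  rw [e2]
  simp only [Function.comp]
  ring

lemma erfc_rpow_lt {l a b : ℝ} (hl : 0 < l) (hab : a < b) :
    erfc (a / Real.sqrt 2) ^ (-l) < erfc (b / Real.sqrt 2) ^ (-l) := by
  apply Real.rpow_lt_rpow_of_neg (erfc_pos _) _ (by linarith)
  apply erfc_strictAnti
  have h2p : 0 < Real.sqrt 2 := by positivity
  gcongr

/-- for every `z ≠ 0` the TTF transformation is differentiable at `z` with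
derivative `σ √(2/π) exp(-z²/2) erfc(|z|/√2)^(-λ_s - 1)` (with `λ_s = λ₊` for `z > 0`
and `λ_s = λ₋` for `z < 0`); this derivative is positive, and `R` is strictly
increasing on `ℝ`. -/
theorem ttfR_hasDerivAt_ne_zero (m σ lp lm : ℝ) (hσ : 0 < σ) (hlp : 0 < lp)
    (hlm : 0 < lm) :
    (∀ z : ℝ, z ≠ 0 →
      HasDerivAt (ttfR m σ lp lm)
        (σ * Real.sqrt (2 / Real.pi) * Real.exp (-z ^ 2 / 2)
          * (erfc (|z| / Real.sqrt 2)) ^ (-(if 0 < z then lp else lm) - 1)) z ∧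
      0 < σ * Real.sqrt (2 / Real.pi) * Real.exp (-z ^ 2 / 2)
          * (erfc (|z| / Real.sqrt 2)) ^ (-(if 0 < z then lp else lm) - 1)) ∧
    StrictMono (ttfR m σ lp lm) := by
  refine ⟨fun z hz => ⟨?_, ?_⟩, ?_⟩
  · rcases lt_or_gt_of_ne hz with h | h
    · rw [if_neg h.not_gt, abs_of_neg h]
      have hd := ((((erfc_rpow_hasDerivAt lm (-1) z (by norm_num)).sub_const 1).const_mul
        (-1 / lm)).const_mul σ).const_add m
      simp only [neg_one_mul] at hd
      refine (hd.congr_of_eventuallyEq ?_).congr_deriv ?_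
      · filter_upwards [Iio_mem_nhds h] with x hx
        have hx' : x < 0 := hx
        simp only [ttfR]
        rw [if_neg hx'.not_ge, abs_of_neg hx']
      · field_simp
    · rw [if_pos h, abs_of_pos h]
      have hd := ((((erfc_rpow_hasDerivAt lp 1 z (by norm_num)).sub_const 1).const_mul
        (1 / lp)).const_mul σ).const_add m
      simp only [one_mul] at hd
      refine (hd.congr_of_eventuallyEq ?_).congr_deriv ?_
      · filter_upwards [Ioi_mem_nhds h] with x hx
        have hx' : 0 < x := hx
        simp only [ttfR]
        rw [if_pos hx'.le, abs_of_pos hx']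
      · field_simp
  · have := Real.rpow_pos_of_pos (erfc_pos (|z| / Real.sqrt 2))
      (-(if 0 < z then lp else lm) - 1)
    have := Real.pi_pos
    positivity
  · have hR : StrictMonoOn (ttfR m σ lp lm) (Set.Ici 0) := by
      intro a ha b hb hab
      have ha' : 0 ≤ a := ha
      have hb' : 0 ≤ b := hb
      have := erfc_rpow_lt hlp hab
      simp only [ttfR]
      rw [if_pos ha', if_pos hb', abs_of_nonneg ha', abs_of_nonneg hb']
      gcongr
    have hval : ∀ x ≤ 0, ttfR m σ lp lm x =
        m - σ * ((1 / lm) * ((erfc (-x / Real.sqrt 2)) ^ (-lm) - 1)) := by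
      intro x hx
      simp only [ttfR]
      rcases hx.lt_or_eq with h | h
      · rw [if_neg h.not_ge, abs_of_neg h]; ring
      · subst h
        simp [erfc_zero]
    have hL : StrictMonoOn (ttfR m σ lp lm) (Set.Iic 0) := by
      intro a ha b hb hab
      rw [hval a ha, hval b hb]
      have := erfc_rpow_lt hlm (neg_lt_neg hab)
      gcongr
    exact hL.Iic_union_Ici hR
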